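/- For every sentence A of arithmetic the following are equivalent: (i) A is true in ℕ; (ii) there exists a ∈ C_rec with End(a) = {A}; (iii) there exists a ∈ C_rec^- with End(a) = {A}. In particular thm(C_rec) = thm(C_rec^-) = the set of true arithmetical sentences. -/

import Mathlib

namespace Shoen

/-- Kleene application: value of the `e`-th partial recursive function at `n`,
in the standard numbering via `Nat.Partrec.Code`. -/
def peval (e n : ℕ) : Part ℕ := (Denumerable.ofNat Nat.Partrec.Code e).eval n

/-- `e` is an index of a (total) primitive recursive function. -/
def PrimIndex (e : ℕ) : Prop := ∃ f : ℕ → ℕ, Nat.Primrec f ∧ ∀ n, peval e n = Part.some (f n)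

/-- Kleene's relation `<_O`. -/
inductive KLt : ℕ → ℕ → Prop
  | base : KLt 1 2
  | step {a b : ℕ} : KLt a b → KLt b (2 ^ b)
  | lim {e : ℕ} (h : ∀ n, (peval e n).Dom)
      (hm : ∀ n, KLt ((peval e n).get (h n)) ((peval e (n + 1)).get (h (n + 1))))
      (n : ℕ) : KLt ((peval e n).get (h n)) (3 * 5 ^ e)
  | trans {a b c : ℕ} : KLt a b → KLt b c → KLt a c

/-- Kleene's `O`. -/
def KO (a : ℕ) : Prop := KLt a (2 ^ a)

/-- The auxiliary relation `<'_O`. -/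
inductive KLt' : ℕ → ℕ → Prop
  | base : KLt' 1 2
  | step {a b : ℕ} : KLt' a b → KLt' b (2 ^ b)
  | lim {e n x : ℕ} : x ∈ peval e n → KLt' x (3 * 5 ^ e)
  | trans {a b c : ℕ} : KLt' a b → KLt' b c → KLt' a c

/-- The inductive characterization `O'` of Kleene's `O`. -/
inductive KO' : ℕ → Prop
  | one : KO' 1
  | step {a : ℕ} : KO' a → KO' (2 ^ a)
  | lim {e : ℕ} (h : ∀ n, (peval e n).Dom)
      (hm : ∀ n, KLt' ((peval e n).get (h n)) ((peval e (n + 1)).get (h (n + 1)))) :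
      KO' (3 * 5 ^ e)



/-! ### Syntax of first order arithmetic (negation normal form) -/

/-- Terms of the language `0,1,+,×,=`, with de Bruijn variables. -/
inductive Trm : Type
  | var : ℕ → Trm
  | zero : Trm
  | one : Trm
  | add : Trm → Trm → Trm
  | mul : Trm → Trm → Trm
deriving DecidableEq

/-- Formulas in negation normal form: literals (atomic and negated atomic
formulas) combined by `∧, ∨, ∀, ∃` (de Bruijn binders). -/
inductive Fml : Type
  | eq : Trm → Trm → Fml
  | ne : Trm → Trm → Fml
  | and : Fml → Fml → Fml
  | or : Fml → Fml → Fml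
  | all : Fml → Fml
  | ex : Fml → Fml
deriving DecidableEq

/-- All free variables of a term are `< k`. -/
def Trm.cu : Trm → ℕ → Bool
  | .var i, k => decide (i < k)
  | .zero, _ => true
  | .one, _ => true
  | .add s t, k => s.cu k && t.cu k
  | .mul s t, k => s.cu k && t.cu k

/-- All free variables of a formula are `< k`. -/
def Fml.cu : Fml → ℕ → Bool
  | .eq s t, k => s.cu k && t.cu k
  | .ne s t, k => s.cu k && t.cu k
  | .and A B, k => A.cu k && B.cu k
  | .or A B, k => A.cu k && B.cu k
  | .all A, k => A.cu (k + 1)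
  | .ex A, k => A.cu (k + 1)

/-- A sentence is a closed formula. -/
abbrev Sentence : Type := { A : Fml // A.cu 0 = true }

/-- Value of a term under an environment. -/
def Trm.val (ρ : ℕ → ℕ) : Trm → ℕ
  | .var i => ρ i
  | .zero => 0
  | .one => 1
  | .add s t => s.val ρ + t.val ρ
  | .mul s t => s.val ρ * t.val ρ

/-- Extend an environment by a value for variable `0`. -/
def consEnv (n : ℕ) (ρ : ℕ → ℕ) : ℕ → ℕ
  | 0 => n
  | k + 1 => ρ k

/-- Satisfaction in the standard model `ℕ`. -/
def Fml.Sat (ρ : ℕ → ℕ) : Fml → Prop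
  | .eq s t => s.val ρ = t.val ρ
  | .ne s t => s.val ρ ≠ t.val ρ
  | .and A B => A.Sat ρ ∧ B.Sat ρ
  | .or A B => A.Sat ρ ∨ B.Sat ρ
  | .all A => ∀ n : ℕ, A.Sat (consEnv n ρ)
  | .ex A => ∃ n : ℕ, A.Sat (consEnv n ρ)

/-- Truth of a sentence in the standard model. -/
def sentTrue (A : Sentence) : Prop := A.1.Sat (fun _ => 0)

/-- Substitution of a closed term `t` for variable `k` in a term. -/
def Trm.sub (t : Trm) (k : ℕ) : Trm → Trm
  | .var i => if i = k then t else if k < i then .var (i - 1) else .var i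
  | .zero => .zero
  | .one => .one
  | .add s u => .add (Trm.sub t k s) (Trm.sub t k u)
  | .mul s u => .mul (Trm.sub t k s) (Trm.sub t k u)

/-- Substitution of a closed term `t` for variable `k` in a formula. -/
def Fml.sub (t : Trm) : Fml → ℕ → Fml
  | .eq s u, k => .eq (Trm.sub t k s) (Trm.sub t k u)
  | .ne s u, k => .ne (Trm.sub t k s) (Trm.sub t k u)
  | .and A B, k => .and (A.sub t k) (B.sub t k)
  | .or A B, k => .or (A.sub t k) (B.sub t k)
  | .all A, k => .all (A.sub t (k + 1))
  | .ex A, k => .ex (A.sub t (k + 1))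

/-- The numeral `n̄`. -/
def numeral : ℕ → Trm
  | 0 => .zero
  | n + 1 => .add (numeral n) .one

theorem Trm.cu_mono : ∀ (t : Trm) {j k : ℕ}, j ≤ k → t.cu j = true → t.cu k = true := by
  intro t
  induction t with
  | var i =>
    intro j k h ht
    simp only [Trm.cu, decide_eq_true_eq] at *
    omega
  | zero => intros; rfl
  | one => intros; rfl
  | add s u ihs ihu =>
    intro j k h ht
    simp only [Trm.cu, Bool.and_eq_true] at *
    exact ⟨ihs h ht.1, ihu h ht.2⟩
  | mul s u ihs ihu =>
    intro j k h ht
    simp only [Trm.cu, Bool.and_eq_true] at *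
    exact ⟨ihs h ht.1, ihu h ht.2⟩

theorem Trm.cu_sub : ∀ (s : Trm) {k : ℕ} {t : Trm},
    t.cu 0 = true → s.cu (k + 1) = true → (Trm.sub t k s).cu k = true := by
  intro s
  induction s with
  | var i =>
    intro k t ht hs
    simp only [Trm.cu, decide_eq_true_eq] at hs
    simp only [Trm.sub]
    by_cases h : i = k
    · rw [if_pos h]
      exact Trm.cu_mono t (Nat.zero_le k) ht
    · have h2 : ¬ k < i := by omega
      rw [if_neg h, if_neg h2]
      simp only [Trm.cu, decide_eq_true_eq]
      omega
  | zero => intros; rfl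
  | one => intros; rfl
  | add s u ihs ihu =>
    intro k t ht hs
    simp only [Trm.cu, Bool.and_eq_true] at hs
    simp only [Trm.sub, Trm.cu, Bool.and_eq_true]
    exact ⟨ihs ht hs.1, ihu ht hs.2⟩
  | mul s u ihs ihu =>
    intro k t ht hs
    simp only [Trm.cu, Bool.and_eq_true] at hs
    simp only [Trm.sub, Trm.cu, Bool.and_eq_true]
    exact ⟨ihs ht hs.1, ihu ht hs.2⟩

theorem Fml.cu_sub : ∀ (A : Fml) {k : ℕ} {t : Trm},
    t.cu 0 = true → A.cu (k + 1) = true → (A.sub t k).cu k = true := by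
  intro A
  induction A with
  | eq s u =>
    intro k t ht hA
    simp only [Fml.cu, Bool.and_eq_true] at hA
    simp only [Fml.sub, Fml.cu, Bool.and_eq_true]
    exact ⟨Trm.cu_sub s ht hA.1, Trm.cu_sub u ht hA.2⟩
  | ne s u =>
    intro k t ht hA
    simp only [Fml.cu, Bool.and_eq_true] at hA
    simp only [Fml.sub, Fml.cu, Bool.and_eq_true]
    exact ⟨Trm.cu_sub s ht hA.1, Trm.cu_sub u ht hA.2⟩
  | and A B ihA ihB =>
    intro k t ht h
    simp only [Fml.cu, Bool.and_eq_true] at h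
    simp only [Fml.sub, Fml.cu, Bool.and_eq_true]
    exact ⟨ihA ht h.1, ihB ht h.2⟩
  | or A B ihA ihB =>
    intro k t ht h
    simp only [Fml.cu, Bool.and_eq_true] at h
    simp only [Fml.sub, Fml.cu, Bool.and_eq_true]
    exact ⟨ihA ht h.1, ihB ht h.2⟩
  | all A ihA =>
    intro k t ht h
    simp only [Fml.cu] at h
    simp only [Fml.sub, Fml.cu]
    exact ihA ht h
  | ex A ihA =>
    intro k t ht h
    simp only [Fml.cu] at h
    simp only [Fml.sub, Fml.cu]
    exact ihA ht h

theorem numeral_cu : ∀ n : ℕ, (numeral n).cu 0 = true := by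
  intro n
  induction n with
  | zero => rfl
  | succ n ih => simp [numeral, Trm.cu, ih]

/-- Negation (de Morgan dual) of a formula in negation normal form. -/
def Fml.neg : Fml → Fml
  | .eq s t => .ne s t
  | .ne s t => .eq s t
  | .and A B => .or A.neg B.neg
  | .or A B => .and A.neg B.neg
  | .all A => .ex A.neg
  | .ex A => .all A.neg

theorem Fml.cu_neg : ∀ (A : Fml) {k : ℕ}, A.cu k = true → A.neg.cu k = true := by
  intro A
  induction A with
  | eq s u => intro k h; simpa [Fml.cu, Fml.neg] using h
  | ne s u => intro k h; simpa [Fml.cu, Fml.neg] using h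
  | and A B ihA ihB =>
    intro k h
    simp only [Fml.cu, Bool.and_eq_true] at h
    simp only [Fml.neg, Fml.cu, Bool.and_eq_true]
    exact ⟨ihA h.1, ihB h.2⟩
  | or A B ihA ihB =>
    intro k h
    simp only [Fml.cu, Bool.and_eq_true] at h
    simp only [Fml.neg, Fml.cu, Bool.and_eq_true]
    exact ⟨ihA h.1, ihB h.2⟩
  | all A ihA =>
    intro k h
    simp only [Fml.cu] at h
    simp only [Fml.neg, Fml.cu]
    exact ihA h
  | ex A ihA =>
    intro k h
    simp only [Fml.cu] at h
    simp only [Fml.neg, Fml.cu]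
    exact ihA h

/-- Conjunction of sentences. -/
def sAnd (A B : Sentence) : Sentence :=
  ⟨.and A.1 B.1, by simp [Fml.cu, A.2, B.2]⟩

/-- Disjunction of sentences. -/
def sOr (A B : Sentence) : Sentence :=
  ⟨.or A.1 B.1, by simp [Fml.cu, A.2, B.2]⟩

/-- Negation of a sentence. -/
def sNeg (A : Sentence) : Sentence := ⟨A.1.neg, Fml.cu_neg A.1 A.2⟩

/-- The sentence `∀x A(x)`, for `A` with (at most) one free variable. -/
def sAll (A : Fml) (h : A.cu 1 = true) : Sentence := ⟨.all A, by simpa [Fml.cu] using h⟩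

/-- The sentence `∃x A(x)`, for `A` with (at most) one free variable. -/
def sEx (A : Fml) (h : A.cu 1 = true) : Sentence := ⟨.ex A, by simpa [Fml.cu] using h⟩

/-- The instance `A(n̄)` of a formula `A` with one free variable. -/
def sInst (A : Fml) (h : A.cu 1 = true) (n : ℕ) : Sentence :=
  ⟨A.sub (numeral n) 0, Fml.cu_sub A (numeral_cu n) h⟩

/-- Literals: atomic and negated atomic formulas. -/
def Fml.isLiteral : Fml → Bool
  | .eq _ _ => true
  | .ne _ _ => true
  | _ => false

/-- Quantifier free formulas. -/
def Fml.qf : Fml → Bool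
  | .eq _ _ => true
  | .ne _ _ => true
  | .and A B => A.qf && B.qf
  | .or A B => A.qf && B.qf
  | .all _ => false
  | .ex _ => false

/-- An axiom is a sequent containing a true closed literal. -/
def IsAxiom (Γ : Finset Sentence) : Prop :=
  ∃ A ∈ Γ, A.1.isLiteral = true ∧ sentTrue A

/-- A sequent is true if some member is true. -/
def SeqTrue (Γ : Finset Sentence) : Prop := ∃ A ∈ Γ, sentTrue A


/-! ### A primitive recursive Gödel numbering of terms, sentences and sequents -/

/-- Gödel number of a term. -/
def Trm.enc : Trm → ℕ
  | .var i => 5 * i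
  | .zero => 1
  | .one => 2
  | .add s t => 5 * Nat.pair s.enc t.enc + 3
  | .mul s t => 5 * Nat.pair s.enc t.enc + 4

/-- Fuelled decoding of terms. -/
def Trm.dec : ℕ → ℕ → Option Trm
  | 0, _ => none
  | fuel + 1, n =>
    if n % 5 = 0 then some (.var (n / 5))
    else if n % 5 = 1 then some .zero
    else if n % 5 = 2 then some .one
    else if n % 5 = 3 then
      match Trm.dec fuel (n / 5).unpair.1, Trm.dec fuel (n / 5).unpair.2 with
      | some s, some t => some (.add s t)
      | _, _ => none
    else
      match Trm.dec fuel (n / 5).unpair.1, Trm.dec fuel (n / 5).unpair.2 with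
      | some s, some t => some (.mul s t)
      | _, _ => none

theorem Trm.dec_enc : ∀ (t : Trm) (fuel : ℕ), t.enc < fuel → Trm.dec fuel t.enc = some t := by
  intro t
  induction t with
  | var i =>
    intro fuel h
    match fuel with
    | f + 1 =>
      have h0 : (5 * i) % 5 = 0 := by omega
      have h1 : (5 * i) / 5 = i := by omega
      simp [Trm.dec, Trm.enc, h0, h1]
  | zero =>
    intro fuel h
    match fuel with
    | f + 1 => simp [Trm.dec, Trm.enc]
  | one =>
    intro fuel h
    match fuel with
    | f + 1 => simp [Trm.dec, Trm.enc]
  | add s u ihs ihu =>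
    intro fuel h
    match fuel with
    | f + 1 =>
      simp only [Trm.enc] at h ⊢
      set p := Nat.pair s.enc u.enc with hp
      have h0 : (5 * p + 3) % 5 = 3 := by omega
      have h1 : (5 * p + 3) / 5 = p := by omega
      have hs : s.enc < f := by
        have := Nat.left_le_pair s.enc u.enc
        omega
      have hu : u.enc < f := by
        have := Nat.right_le_pair s.enc u.enc
        omega
      simp only [Trm.dec, h0, h1]
      rw [hp, Nat.unpair_pair, ihs f hs, ihu f hu]
      simp
  | mul s u ihs ihu =>
    intro fuel h
    match fuel with
    | f + 1 =>
      simp only [Trm.enc] at h ⊢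
      set p := Nat.pair s.enc u.enc with hp
      have h0 : (5 * p + 4) % 5 = 4 := by omega
      have h1 : (5 * p + 4) / 5 = p := by omega
      have hs : s.enc < f := by
        have := Nat.left_le_pair s.enc u.enc
        omega
      have hu : u.enc < f := by
        have := Nat.right_le_pair s.enc u.enc
        omega
      simp only [Trm.dec, h0, h1]
      rw [hp, Nat.unpair_pair, ihs f hs, ihu f hu]
      simp

instance : Encodable Trm :=
  ⟨Trm.enc, fun n => Trm.dec (n + 1) n, fun t => Trm.dec_enc t _ (Nat.lt_succ_self _)⟩

/-- Gödel number of a formula. -/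
def Fml.enc : Fml → ℕ
  | .eq s t => 6 * Nat.pair s.enc t.enc
  | .ne s t => 6 * Nat.pair s.enc t.enc + 1
  | .and A B => 6 * Nat.pair A.enc B.enc + 2
  | .or A B => 6 * Nat.pair A.enc B.enc + 3
  | .all A => 6 * A.enc + 4
  | .ex A => 6 * A.enc + 5

/-- Fuelled decoding of formulas. -/
def Fml.dec : ℕ → ℕ → Option Fml
  | 0, _ => none
  | fuel + 1, n =>
    if n % 6 = 0 then
      match Encodable.decode (α := Trm) (n / 6).unpair.1,
            Encodable.decode (α := Trm) (n / 6).unpair.2 with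
      | some s, some t => some (.eq s t)
      | _, _ => none
    else if n % 6 = 1 then
      match Encodable.decode (α := Trm) (n / 6).unpair.1,
            Encodable.decode (α := Trm) (n / 6).unpair.2 with
      | some s, some t => some (.ne s t)
      | _, _ => none
    else if n % 6 = 2 then
      match Fml.dec fuel (n / 6).unpair.1, Fml.dec fuel (n / 6).unpair.2 with
      | some A, some B => some (.and A B)
      | _, _ => none
    else if n % 6 = 3 then
      match Fml.dec fuel (n / 6).unpair.1, Fml.dec fuel (n / 6).unpair.2 with
      | some A, some B => some (.or A B)
      | _, _ => none
    else if n % 6 = 4 then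
      match Fml.dec fuel (n / 6) with
      | some A => some (.all A)
      | none => none
    else
      match Fml.dec fuel (n / 6) with
      | some A => some (.ex A)
      | none => none

theorem Fml.dec_enc : ∀ (A : Fml) (fuel : ℕ), A.enc < fuel → Fml.dec fuel A.enc = some A := by
  intro A
  induction A with
  | eq s u =>
    intro fuel h
    match fuel with
    | f + 1 =>
      simp only [Fml.enc] at h ⊢
      set p := Nat.pair s.enc u.enc with hp
      have h0 : (6 * p) % 6 = 0 := by omega
      have h1 : (6 * p) / 6 = p := by omega
      have hds : Encodable.decode (α := Trm) s.enc = some s := Encodable.encodek s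
      have hdu : Encodable.decode (α := Trm) u.enc = some u := Encodable.encodek u
      simp only [Fml.dec, h0, h1]
      rw [hp, Nat.unpair_pair, hds, hdu]
      simp
  | ne s u =>
    intro fuel h
    match fuel with
    | f + 1 =>
      simp only [Fml.enc] at h ⊢
      set p := Nat.pair s.enc u.enc with hp
      have h0 : (6 * p + 1) % 6 = 1 := by omega
      have h1 : (6 * p + 1) / 6 = p := by omega
      have hds : Encodable.decode (α := Trm) s.enc = some s := Encodable.encodek s
      have hdu : Encodable.decode (α := Trm) u.enc = some u := Encodable.encodek u
      simp only [Fml.dec, h0, h1]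
      rw [hp, Nat.unpair_pair, hds, hdu]
      simp
  | and A B ihA ihB =>
    intro fuel h
    match fuel with
    | f + 1 =>
      simp only [Fml.enc] at h ⊢
      set p := Nat.pair A.enc B.enc with hp
      have h0 : (6 * p + 2) % 6 = 2 := by omega
      have h1 : (6 * p + 2) / 6 = p := by omega
      have hA : A.enc < f := by
        have := Nat.left_le_pair A.enc B.enc
        omega
      have hB : B.enc < f := by
        have := Nat.right_le_pair A.enc B.enc
        omega
      simp only [Fml.dec, h0, h1]
      rw [hp, Nat.unpair_pair, ihA f hA, ihB f hB]
      simp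
  | or A B ihA ihB =>
    intro fuel h
    match fuel with
    | f + 1 =>
      simp only [Fml.enc] at h ⊢
      set p := Nat.pair A.enc B.enc with hp
      have h0 : (6 * p + 3) % 6 = 3 := by omega
      have h1 : (6 * p + 3) / 6 = p := by omega
      have hA : A.enc < f := by
        have := Nat.left_le_pair A.enc B.enc
        omega
      have hB : B.enc < f := by
        have := Nat.right_le_pair A.enc B.enc
        omega
      simp only [Fml.dec, h0, h1]
      rw [hp, Nat.unpair_pair, ihA f hA, ihB f hB]
      simp
  | all A ihA =>
    intro fuel h
    match fuel with
    | f + 1 =>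
      simp only [Fml.enc] at h ⊢
      have h0 : (6 * A.enc + 4) % 6 = 4 := by omega
      have h1 : (6 * A.enc + 4) / 6 = A.enc := by omega
      have hA : A.enc < f := by omega
      simp [Fml.dec, h0, h1, ihA f hA]
  | ex A ihA =>
    intro fuel h
    match fuel with
    | f + 1 =>
      simp only [Fml.enc] at h ⊢
      have h0 : (6 * A.enc + 5) % 6 = 5 := by omega
      have h1 : (6 * A.enc + 5) / 6 = A.enc := by omega
      have hA : A.enc < f := by omega
      simp [Fml.dec, h0, h1, ihA f hA]

instance : Encodable Fml :=
  ⟨Fml.enc, fun n => Fml.dec (n + 1) n, fun A => Fml.dec_enc A _ (Nat.lt_succ_self _)⟩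

/-- Gödel number of a sentence. -/
def encF (A : Sentence) : ℕ := Encodable.encode A

/-- Gödel number of a sequent (finite set of sentences). -/
def encS (Γ : Finset Sentence) : ℕ := Encodable.encode Γ

/-- Decode a Gödel number into a sentence (with a default value). -/
def decF (n : ℕ) : Sentence := (Encodable.decode (α := Sentence) n).getD ⟨.eq .zero .zero, rfl⟩

/-- Decode a Gödel number into a sequent (with a default value). -/
def decS (n : ℕ) : Finset Sentence := (Encodable.decode (α := Finset Sentence) n).getD ∅

/-! ### Tupling of natural numbers, with projections -/

/-- Code of a finite sequence (tuple) of natural numbers; codes are nonzero. -/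
def tup (l : List ℕ) : ℕ := Encodable.encode l + 1

/-- The finite sequence coded by a natural number. -/
def untup (a : ℕ) : List ℕ := Denumerable.ofNat (List ℕ) (a - 1)

/-- The `i`-th projection `(a)_i`. -/
def proj (a i : ℕ) : ℕ := (untup a).getD i 0

/-- `a` codes a finite sequence (every nonzero number does, bijectively). -/
def InSeq (a : ℕ) : Prop := a ≠ 0

/-- The code of the empty sequence `⟨⟩` (the root). -/
def rootSeq : ℕ := tup []

/-- The code of `σ⌢i`. -/
def snoc (σ i : ℕ) : ℕ := tup (untup σ ++ [i])

/-! ### Names for the inference rules -/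

def axC : ℕ := 1
def andC : ℕ := 2
def orC : ℕ := 3
def omC : ℕ := 4
def exC : ℕ := 5
def cutC : ℕ := 6
def omrepC : ℕ := 7

/-- The end sequent of a (code of a) proof or proof node: `(a)_1` if the rule
`(a)_0` carries no main formula, and `(a)_1 ∪ {(a)_2}` otherwise. -/
def EndS (a : ℕ) : Finset Sentence :=
  if proj a 0 = cutC ∨ proj a 0 = axC ∨ proj a 0 = omrepC then decS (proj a 1)
  else decS (proj a 1) ∪ {decF (proj a 2)}

/-! ### Local codes of ω-proofs -/

/-- Local codes of `ω`-proofs, in Tait style.  The three `Bool` parameters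
respectively allow the cut rule, restrict the `ω`-rule to indices of primitive
recursive functions, and allow the vacuous `ω`-repetition rule. -/
inductive CGen (c p r : Bool) : ℕ → Prop
  | ax (Γ : Finset Sentence) (h : IsAxiom Γ) : CGen c p r (tup [axC, encS Γ])
  | and {a b : ℕ} (Γ : Finset Sentence) (A B : Sentence)
      (ha : CGen c p r a) (hb : CGen c p r b)
      (ea : EndS a = Γ ∪ {A}) (eb : EndS b = Γ ∪ {B}) :
      CGen c p r (tup [andC, encS Γ, encF (sAnd A B), a, b])
  | or {a : ℕ} (Γ : Finset Sentence) (A B : Sentence) (ha : CGen c p r a)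
      (ea : EndS a = Γ ∪ {A, B}) :
      CGen c p r (tup [orC, encS Γ, encF (sOr A B), a])
  | om {e : ℕ} (Γ : Finset Sentence) (A : Fml) (hA : A.cu 1 = true)
      (hp : p = true → PrimIndex e)
      (htot : ∀ n, (peval e n).Dom)
      (hmem : ∀ n, CGen c p r ((peval e n).get (htot n)))
      (hend : ∀ n, EndS ((peval e n).get (htot n)) = Γ ∪ {sInst A hA n}) :
      CGen c p r (tup [omC, encS Γ, encF (sAll A hA), e])
  | ex {a : ℕ} (Γ : Finset Sentence) (A : Fml) (hA : A.cu 1 = true) (n : ℕ)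
      (ha : CGen c p r a) (ea : EndS a = Γ ∪ {sInst A hA n}) :
      CGen c p r (tup [exC, encS Γ, encF (sEx A hA), a])
  | cut {a b : ℕ} (hc : c = true) (Γ : Finset Sentence) (C : Sentence)
      (ha : CGen c p r a) (hb : CGen c p r b)
      (ea : EndS a = Γ ∪ {C}) (eb : EndS b = Γ ∪ {sNeg C}) :
      CGen c p r (tup [cutC, encS Γ, encF C, a, b])
  | omrep {e : ℕ} (hr : r = true) (Γ : Finset Sentence) (hp : PrimIndex e)
      (htot : ∀ n, (peval e n).Dom)
      (hmem : ∀ n, CGen c p r ((peval e n).get (htot n)))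
      (hend : ∀ n, EndS ((peval e n).get (htot n)) = Γ) :
      CGen c p r (tup [omrepC, encS Γ, e])

/-- `C_rec`: recursive local codes of `ω`-proofs. -/
def Crec : ℕ → Prop := CGen true false false

/-- `C_rec^-`: the cut free fragment of `C_rec`. -/
def CrecM : ℕ → Prop := CGen false false false

/-- `C_prec`: primitive recursive local codes of `ω`-proofs. -/
def Cprec : ℕ → Prop := CGen true true false

/-- `C_prec^-`: the cut free fragment of `C_prec`. -/
def CprecM : ℕ → Prop := CGen false true false

/-- `C_prec^{ω-rep}`: `C_prec` with the vacuous `ω`-repetition rule. -/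
def CprecRep : ℕ → Prop := CGen true true true

/-! ### ω-proofs as well founded trees of sequents -/

/-- `σ` is a node of the tree `T_π = {σ ∈ Seq : π(σ) ∈ Seq}`. -/
def TreeOf (π : ℕ → ℕ) (σ : ℕ) : Prop := σ ≠ 0 ∧ π σ ≠ 0

/-- The tree `T_π` is well founded: it has no infinite branch. -/
def WFTree (π : ℕ → ℕ) : Prop :=
  ¬ ∃ f : ℕ → ℕ, ∀ n : ℕ, TreeOf π (tup ((List.range n).map f))

/-- The inference at an inner node of an `ω`-proof is a correct instance of one
of the rules of Tait-style `ω`-arithmetic. -/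
def CorrectInner (π : ℕ → ℕ) (σ : ℕ) : Prop :=
  (∃ (Γ : Finset Sentence) (A B : Sentence),
    π σ = tup [andC, encS Γ, encF (sAnd A B)] ∧
    TreeOf π (snoc σ 0) ∧ TreeOf π (snoc σ 1) ∧ ¬ TreeOf π (snoc σ 2) ∧
    EndS (π (snoc σ 0)) = Γ ∪ {A} ∧ EndS (π (snoc σ 1)) = Γ ∪ {B}) ∨
  (∃ (Γ : Finset Sentence) (A B : Sentence),
    π σ = tup [orC, encS Γ, encF (sOr A B)] ∧
    TreeOf π (snoc σ 0) ∧ ¬ TreeOf π (snoc σ 1) ∧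
    EndS (π (snoc σ 0)) = Γ ∪ {A, B}) ∨
  (∃ (Γ : Finset Sentence) (A : Fml) (hA : A.cu 1 = true),
    π σ = tup [omC, encS Γ, encF (sAll A hA)] ∧
    (∀ n : ℕ, TreeOf π (snoc σ n)) ∧
    (∀ n : ℕ, EndS (π (snoc σ n)) = Γ ∪ {sInst A hA n})) ∨
  (∃ (Γ : Finset Sentence) (A : Fml) (hA : A.cu 1 = true) (n : ℕ),
    π σ = tup [exC, encS Γ, encF (sEx A hA)] ∧
    TreeOf π (snoc σ 0) ∧ ¬ TreeOf π (snoc σ 1) ∧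
    EndS (π (snoc σ 0)) = Γ ∪ {sInst A hA n}) ∨
  (∃ (Γ : Finset Sentence) (C : Sentence),
    π σ = tup [cutC, encS Γ, encF C] ∧
    TreeOf π (snoc σ 0) ∧ TreeOf π (snoc σ 1) ∧ ¬ TreeOf π (snoc σ 2) ∧
    EndS (π (snoc σ 0)) = Γ ∪ {C} ∧ EndS (π (snoc σ 1)) = Γ ∪ {sNeg C})

/-- Local correctness of a function `π : ℕ → ℕ` viewed as a tree of sequents:
all conditions in the definition of `ω`-proof except well-foundedness. -/
structure LocallyCorrect (π : ℕ → ℕ) : Prop where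
  /-- values outside `Seq` are `0` -/
  nonseq : ∀ σ, ¬ InSeq (π σ) → π σ = 0
  /-- `T_π` is closed under initial segments -/
  downward : ∀ σ τ, TreeOf π σ → τ ≠ 0 → untup τ <+: untup σ → TreeOf π τ
  /-- children come first -/
  mono : ∀ σ i j, i < j → TreeOf π (snoc σ j) → TreeOf π (snoc σ i)
  /-- top nodes are axioms -/
  top : ∀ σ, TreeOf π σ → ¬ TreeOf π (snoc σ 0) →
    ∃ Γ : Finset Sentence, IsAxiom Γ ∧ π σ = tup [axC, encS Γ]
  /-- inner nodes are correct inferences -/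
  inner : ∀ σ, TreeOf π σ → TreeOf π (snoc σ 0) → CorrectInner π σ

/-- `π : ℕ → ℕ` is an `ω`-proof. -/
structure IsOmegaProof (π : ℕ → ℕ) extends LocallyCorrect π : Prop where
  /-- the tree `T_π` is well founded -/
  wf : WFTree π

/-- An `ω`-proof is cut free if no node is labelled `cut`. -/
def CutFree (π : ℕ → ℕ) : Prop := ∀ σ, TreeOf π σ → proj (π σ) 0 ≠ cutC

/-! ### The ω-proof `π(a)` coded by a local code `a` -/

open Classical in
/-- The code of the subproof at child `n` of the proof coded by `a`. -/
noncomputable def childCode (a n : ℕ) : ℕ :=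
  if proj a 0 = omC then
    (if h : (peval (proj a 3) n).Dom then (peval (proj a 3) n).get h else 0)
  else if proj a 0 = andC ∨ proj a 0 = orC ∨ proj a 0 = exC ∨ proj a 0 = cutC then
    proj a (n + 3)
  else 0

/-- Walk down a local code along a path. -/
noncomputable def walkCode (a : ℕ) : List ℕ → ℕ
  | [] => a
  | i :: l => walkCode (childCode a i) l

/-- The node label `⟨R,Γ,A⟩` (or `⟨Ax,Γ⟩`) determined by a local code. -/
def nodeVal (b : ℕ) : ℕ :=
  if proj b 0 = axC then tup [axC, proj b 1]
  else if proj b 0 = andC ∨ proj b 0 = orC ∨ proj b 0 = omC ∨ proj b 0 = exC ∨ proj b 0 = cutC then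
    tup [proj b 0, proj b 1, proj b 2]
  else 0

/-- The `ω`-proof `π(a)` determined by a local code `a` (with value `0` at all
other arguments). -/
noncomputable def piOf (a : ℕ) (σ : ℕ) : ℕ :=
  if σ = 0 then 0 else nodeVal (walkCode a (untup σ))

/-! ### Indices (global codes) of recursive and primitive recursive ω-proofs -/

/-- `I_rec`: `a` is an index of a recursive `ω`-proof. -/
def Irec (a : ℕ) : Prop :=
  ∃ h : ∀ n, (peval a n).Dom, IsOmegaProof (fun n => (peval a n).get (h n))

/-- `I_prec`: `a` is an index of a primitive recursive `ω`-proof. -/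
def Iprec (a : ℕ) : Prop :=
  ∃ f : ℕ → ℕ, Nat.Primrec f ∧ (∀ n, peval a n = Part.some (f n)) ∧ IsOmegaProof f

/-- `I_prec^-`: `a` is an index of a primitive recursive cut free `ω`-proof. -/
def IprecM (a : ℕ) : Prop :=
  ∃ f : ℕ → ℕ, Nat.Primrec f ∧ (∀ n, peval a n = Part.some (f n)) ∧
    IsOmegaProof f ∧ CutFree f

/-! ### Ordinal lengths -/

open Classical in
/-- `x + 1` if `P` holds, and `0` otherwise. -/
noncomputable def succIf (P : Prop) (x : Ordinal.{0}) : Ordinal.{0} :=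
  if P then x + 1 else 0

/-- The ordinal rank of a node of the tree `T_π`:
`rank σ = sup {rank (σ⌢i) + 1 : σ⌢i ∈ T_π}`. -/
inductive NodeRank (π : ℕ → ℕ) : ℕ → Ordinal.{0} → Prop
  | mk (σ : ℕ) (o : ℕ → Ordinal.{0})
      (h : ∀ i, TreeOf π (snoc σ i) → NodeRank π (snoc σ i) (o i)) :
      NodeRank π σ (⨆ i, succIf (TreeOf π (snoc σ i)) (o i))

/-- The ordinal length of a local code:  `|⟨Ax,Γ⟩| = 0`,
`|⟨R,Γ,A,a₁,…,a_k⟩| = sup{|a₁|,…,|a_k|} + 1`, and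
`|⟨ω,Γ,∀xA(x),e⟩| = sup{|⟨e⟩(n)| + 1 : n ∈ ℕ}`. -/
inductive CLen : ℕ → Ordinal.{0} → Prop
  | ax (g : ℕ) : CLen (tup [axC, g]) 0
  | one (R g x a : ℕ) (o : Ordinal.{0}) (hR : R = orC ∨ R = exC) (h : CLen a o) :
      CLen (tup [R, g, x, a]) (o + 1)
  | two (R g x a b : ℕ) (oa ob : Ordinal.{0}) (hR : R = andC ∨ R = cutC)
      (ha : CLen a oa) (hb : CLen b ob) :
      CLen (tup [R, g, x, a, b]) ((oa ⊔ ob) + 1)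
  | om (g x e : ℕ) (h : ∀ n, (peval e n).Dom) (o : ℕ → Ordinal.{0})
      (ho : ∀ n, CLen ((peval e n).get (h n)) (o n)) :
      CLen (tup [omC, g, x, e]) (⨆ n, o n + 1)

/-- The ordinal `|a|` of a notation `a ∈ O`:  `|1| = 0`, `|2^a| = |a| + 1`,
`|3·5^e| = sup{|⟨e⟩(n)| : n ∈ ℕ}`. -/
inductive KOrd : ℕ → Ordinal.{0} → Prop
  | one : KOrd 1 0
  | step {a : ℕ} {o : Ordinal.{0}} : KOrd a o → KOrd (2 ^ a) (o + 1)
  | lim {e : ℕ} (h : ∀ n, (peval e n).Dom) (o : ℕ → Ordinal.{0})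
      (ho : ∀ n, KOrd ((peval e n).get (h n)) (o n)) :
      KOrd (3 * 5 ^ e) (⨆ n, o n)


open Classical in
/-- One step of the sequence `a(f)` determined by a local code. -/
noncomputable def branchStep (b k : ℕ) : Option ℕ :=
  if (∃ (Γ : Finset Sentence) (A B : Sentence) (b₀ b₁ : ℕ),
        b = tup [andC, encS Γ, encF (sAnd A B), b₀, b₁]) ∨
     (∃ (Γ : Finset Sentence) (C : Sentence) (b₀ b₁ : ℕ),
        b = tup [cutC, encS Γ, encF C, b₀, b₁]) then
    some (proj b (3 + k % 2))
  else if ∃ (Γ : Finset Sentence) (A B : Sentence) (c : ℕ),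
      b = tup [orC, encS Γ, encF (sOr A B), c] then
    some (proj b 3)
  else if ∃ (Γ : Finset Sentence) (A : Fml) (hA : A.cu 1 = true) (e : ℕ),
      b = tup [omC, encS Γ, encF (sAll A hA), e] then
    (if h : (peval (proj b 3) k).Dom then some ((peval (proj b 3) k).get h) else none)
  else none

/-- The sequence `a(f) = ⟨a₀,a₁,…⟩`:  `chain a f i = some aᵢ` if the `i`-th
element of the sequence is defined, and `none` otherwise. -/
noncomputable def chain (a : ℕ) (f : ℕ → ℕ) : ℕ → Option ℕ
  | 0 => some a
  | i + 1 =>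
    match chain a f i with
    | none => none
    | some b => branchStep b (f i)

open Encodable Denumerable Nat.Partrec

/-! ### Codes of tuples and end sequents -/

theorem proj_tup (l : List ℕ) (i : ℕ) : proj (tup l) i = l.getD i 0 := by
  simp [proj, untup, tup]

theorem decS_encS (Γ : Finset Sentence) : decS (encS Γ) = Γ := by
  simp [decS, encS]

theorem decF_encF (A : Sentence) : decF (encF A) = A := by
  simp [decF, encF]

theorem EndS_ax (Γ : Finset Sentence) : EndS (tup [axC, encS Γ]) = Γ := by
  simp [EndS, proj_tup, decS_encS]

theorem EndS_cut (Γ : Finset Sentence) (l : List ℕ) : EndS (tup (cutC :: encS Γ :: l)) = Γ := by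
  simp [EndS, proj_tup, decS_encS]

theorem EndS_omrep (Γ : Finset Sentence) (l : List ℕ) :
    EndS (tup (omrepC :: encS Γ :: l)) = Γ := by
  simp [EndS, proj_tup, decS_encS]

theorem EndS_principal {R : ℕ} (hR : R ≠ cutC ∧ R ≠ axC ∧ R ≠ omrepC) (Γ : Finset Sentence)
    (A : Sentence) (l : List ℕ) : EndS (tup (R :: encS Γ :: encF A :: l)) = Γ ∪ {A} := by
  simp [EndS, proj_tup, decS_encS, decF_encF, hR]

/-! ### Soundness -/

/-- The environment `ρ` with the value `n` inserted at position `k`. -/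
def insertEnv (n k : ℕ) (ρ : ℕ → ℕ) (i : ℕ) : ℕ :=
  if i = k then n else if k < i then ρ (i - 1) else ρ i

theorem consEnv_insertEnv (m n k : ℕ) (ρ : ℕ → ℕ) :
    consEnv m (insertEnv n k ρ) = insertEnv n (k + 1) (consEnv m ρ) := by
  funext i
  rcases i with _ | i
  · simp [consEnv, insertEnv]
  · rcases i with _ | i <;> simp [consEnv, insertEnv, eq_comm]

theorem insertEnv_zero (n : ℕ) (ρ : ℕ → ℕ) : insertEnv n 0 ρ = consEnv n ρ := by
  funext i
  rcases i with _ | i <;> simp [consEnv, insertEnv]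

theorem val_numeral (ρ : ℕ → ℕ) (n : ℕ) : (numeral n).val ρ = n := by
  induction n with
  | zero => rfl
  | succ n ih => simp [numeral, Trm.val, ih]

theorem Trm.val_sub_numeral (n k : ℕ) (ρ : ℕ → ℕ) (s : Trm) :
    (Trm.sub (numeral n) k s).val ρ = s.val (insertEnv n k ρ) := by
  induction s with
  | var i => simp only [Trm.sub, Trm.val, insertEnv]; split_ifs <;> simp [Trm.val, val_numeral]
  | zero => rfl
  | one => rfl
  | add s u ihs ihu => simp [Trm.sub, Trm.val, ihs, ihu]
  | mul s u ihs ihu => simp [Trm.sub, Trm.val, ihs, ihu]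

theorem Fml.sat_sub_numeral (n : ℕ) (A : Fml) (k : ℕ) (ρ : ℕ → ℕ) :
    (A.sub (numeral n) k).Sat ρ ↔ A.Sat (insertEnv n k ρ) := by
  induction A generalizing k ρ with
  | eq s u => simp [Fml.sub, Fml.Sat, Trm.val_sub_numeral]
  | ne s u => simp [Fml.sub, Fml.Sat, Trm.val_sub_numeral]
  | and A B ihA ihB => simp [Fml.sub, Fml.Sat, ihA, ihB]
  | or A B ihA ihB => simp [Fml.sub, Fml.Sat, ihA, ihB]
  | all A ih => simp [Fml.sub, Fml.Sat, ih, consEnv_insertEnv]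
  | ex A ih => simp [Fml.sub, Fml.Sat, ih, consEnv_insertEnv]

theorem sentTrue_sInst (A : Fml) (hA : A.cu 1 = true) (n : ℕ) :
    sentTrue (sInst A hA n) ↔ A.Sat (consEnv n fun _ => 0) := by
  rw [← insertEnv_zero]
  exact Fml.sat_sub_numeral n A 0 _

theorem Fml.sat_neg (A : Fml) (ρ : ℕ → ℕ) : A.neg.Sat ρ ↔ ¬ A.Sat ρ := by
  induction A generalizing ρ with
  | eq s u => simp [Fml.neg, Fml.Sat]
  | ne s u => simp [Fml.neg, Fml.Sat]
  | and A B ihA ihB => simp [Fml.neg, Fml.Sat, ihA, ihB, imp_iff_not_or]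
  | or A B ihA ihB => simp [Fml.neg, Fml.Sat, ihA, ihB]
  | all A ih => simp [Fml.neg, Fml.Sat, ih]
  | ex A ih => simp [Fml.neg, Fml.Sat, ih]

theorem seqTrue_union (Γ Δ : Finset Sentence) :
    SeqTrue (Γ ∪ Δ) ↔ SeqTrue Γ ∨ SeqTrue Δ := by
  simp [SeqTrue, or_and_right, exists_or]

theorem seqTrue_singleton (A : Sentence) : SeqTrue {A} ↔ sentTrue A := by
  simp [SeqTrue]

theorem seqTrue_pair (A B : Sentence) : SeqTrue {A, B} ↔ sentTrue A ∨ sentTrue B := by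
  simp [SeqTrue]

/-- Every local code of an `ω`-proof has a true end sequent. -/
theorem CGen.seqTrue_EndS {c p r : Bool} {a : ℕ} (h : CGen c p r a) : SeqTrue (EndS a) := by
  induction h with
  | ax Γ h =>
    obtain ⟨A, hA, -, hT⟩ := h
    rw [EndS_ax]
    exact ⟨A, hA, hT⟩
  | and Γ A B _ _ ea eb iha ihb =>
    rw [ea, seqTrue_union, seqTrue_singleton] at iha
    rw [eb, seqTrue_union, seqTrue_singleton] at ihb
    rw [EndS_principal (by decide), seqTrue_union, seqTrue_singleton]
    have : sentTrue (sAnd A B) ↔ sentTrue A ∧ sentTrue B := Iff.rfl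
    tauto
  | or Γ A B _ ea iha =>
    rw [ea, seqTrue_union, seqTrue_pair] at iha
    rw [EndS_principal (by decide), seqTrue_union, seqTrue_singleton]
    exact iha
  | om Γ A hA _ htot _ hend ih =>
    rw [EndS_principal (by decide), seqTrue_union, seqTrue_singleton]
    by_cases hΓ : SeqTrue Γ
    · exact Or.inl hΓ
    · refine Or.inr fun n => ?_
      have hn := ih n
      rw [hend, seqTrue_union, seqTrue_singleton, sentTrue_sInst] at hn
      exact hn.resolve_left hΓ
  | ex Γ A hA n _ ea iha =>
    rw [ea, seqTrue_union, seqTrue_singleton, sentTrue_sInst] at iha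
    rw [EndS_principal (by decide), seqTrue_union, seqTrue_singleton]
    exact iha.imp_right fun h => ⟨n, h⟩
  | cut _ Γ C _ _ ea eb iha ihb =>
    rw [ea, seqTrue_union, seqTrue_singleton] at iha
    rw [eb, seqTrue_union, seqTrue_singleton] at ihb
    have : sentTrue (sNeg C) ↔ ¬ sentTrue C := Fml.sat_neg _ _
    rw [EndS_cut]
    tauto
  | omrep _ Γ _ htot _ hend ih =>
    rw [EndS_omrep, ← hend 0]
    exact ih 0

/-! ### Closing a formula by a list of numerals -/

/-- Substitution of the numerals of `ρ` (and `0̄` afterwards) for the variables `k, k + 1, …`. -/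
def Trm.close (ρ : List ℕ) (k : ℕ) : Trm → Trm
  | .var i => if i < k then .var i else numeral (ρ.getD (i - k) 0)
  | .zero => .zero
  | .one => .one
  | .add s u => .add (s.close ρ k) (u.close ρ k)
  | .mul s u => .mul (s.close ρ k) (u.close ρ k)

/-- Substitution of the numerals of `ρ` (and `0̄` afterwards) for the variables `k, k + 1, …`. -/
def Fml.close (ρ : List ℕ) : Fml → ℕ → Fml
  | .eq s u, k => .eq (s.close ρ k) (u.close ρ k)
  | .ne s u, k => .ne (s.close ρ k) (u.close ρ k)
  | .and A B, k => .and (A.close ρ k) (B.close ρ k)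
  | .or A B, k => .or (A.close ρ k) (B.close ρ k)
  | .all A, k => .all (A.close ρ (k + 1))
  | .ex A, k => .ex (A.close ρ (k + 1))

theorem Trm.cu_close (ρ : List ℕ) (k : ℕ) (s : Trm) : (s.close ρ k).cu k = true := by
  induction s with
  | var i =>
    simp only [Trm.close]
    split_ifs with h
    · simpa [Trm.cu] using h
    · exact Trm.cu_mono _ (Nat.zero_le k) (numeral_cu _)
  | zero => rfl
  | one => rfl
  | add s u ihs ihu => simp [Trm.close, Trm.cu, ihs, ihu]
  | mul s u ihs ihu => simp [Trm.close, Trm.cu, ihs, ihu]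

theorem Fml.cu_close (ρ : List ℕ) (A : Fml) (k : ℕ) : (A.close ρ k).cu k = true := by
  induction A generalizing k with
  | eq s u => simp [Fml.close, Fml.cu, Trm.cu_close]
  | ne s u => simp [Fml.close, Fml.cu, Trm.cu_close]
  | and A B ihA ihB => simp [Fml.close, Fml.cu, ihA, ihB]
  | or A B ihA ihB => simp [Fml.close, Fml.cu, ihA, ihB]
  | all A ih => simp [Fml.close, Fml.cu, ih]
  | ex A ih => simp [Fml.close, Fml.cu, ih]

theorem sub_numeral (t : Trm) (k n : ℕ) : Trm.sub t k (numeral n) = numeral n := by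
  induction n with
  | zero => rfl
  | succ n ih => simp [numeral, Trm.sub, ih]

theorem Trm.sub_close (n : ℕ) (ρ : List ℕ) (k : ℕ) (s : Trm) :
    Trm.sub (numeral n) k (s.close ρ (k + 1)) = s.close (n :: ρ) k := by
  induction s with
  | var i =>
    rcases lt_trichotomy i k with h | rfl | h
    · simp [Trm.close, Trm.sub, h, h.ne, Nat.lt_succ_of_lt h, h.le]
    · simp [Trm.close, Trm.sub]
    · obtain ⟨d, rfl⟩ := Nat.exists_eq_add_of_lt h
      have h₁ : ¬ k + d + 1 < k + 1 := by omega
      have h₂ : ¬ k + d + 1 < k := by omega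
      have h₃ : k + d + 1 - k = d + 1 := by omega
      have h₄ : k + d + 1 - (k + 1) = d := by omega
      simp only [Trm.close, if_neg h₁, if_neg h₂, sub_numeral, h₃, h₄, List.getD_cons_succ]
  | zero => rfl
  | one => rfl
  | add s u ihs ihu => simp [Trm.close, Trm.sub, ihs, ihu]
  | mul s u ihs ihu => simp [Trm.close, Trm.sub, ihs, ihu]

theorem Fml.sub_close (n : ℕ) (ρ : List ℕ) (A : Fml) (k : ℕ) :
    (A.close ρ (k + 1)).sub (numeral n) k = A.close (n :: ρ) k := by
  induction A generalizing k with
  | eq s u => simp [Fml.close, Fml.sub, Trm.sub_close]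
  | ne s u => simp [Fml.close, Fml.sub, Trm.sub_close]
  | and A B ihA ihB => simp [Fml.close, Fml.sub, ihA, ihB]
  | or A B ihA ihB => simp [Fml.close, Fml.sub, ihA, ihB]
  | all A ih => simp [Fml.close, Fml.sub, ih]
  | ex A ih => simp [Fml.close, Fml.sub, ih]

theorem Trm.close_of_cu (ρ : List ℕ) (k : ℕ) (s : Trm) (h : s.cu k = true) :
    s.close ρ k = s := by
  induction s with
  | var i => simp_all [Trm.close, Trm.cu]
  | zero => rfl
  | one => rfl
  | add s u ihs ihu => simp_all [Trm.close, Trm.cu]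
  | mul s u ihs ihu => simp_all [Trm.close, Trm.cu]

theorem Fml.close_of_cu (ρ : List ℕ) (A : Fml) (k : ℕ) (h : A.cu k = true) :
    A.close ρ k = A := by
  induction A generalizing k with
  | eq s u => simp_all [Fml.close, Fml.cu, Trm.close_of_cu]
  | ne s u => simp_all [Fml.close, Fml.cu, Trm.close_of_cu]
  | and A B ihA ihB => simp_all [Fml.close, Fml.cu]
  | or A B ihA ihB => simp_all [Fml.close, Fml.cu]
  | all A ih => simp_all [Fml.close, Fml.cu]
  | ex A ih => simp_all [Fml.close, Fml.cu]

/-- The environment with values `ρ`, and `0` afterwards. -/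
def listEnv (ρ : List ℕ) (i : ℕ) : ℕ := ρ.getD i 0

theorem consEnv_listEnv (n : ℕ) (ρ : List ℕ) : consEnv n (listEnv ρ) = listEnv (n :: ρ) := by
  funext i
  rcases i with _ | i <;> simp [consEnv, listEnv]

theorem Trm.val_close (σ : ℕ → ℕ) (ρ : List ℕ) (s : Trm) :
    (s.close ρ 0).val σ = s.val (listEnv ρ) := by
  induction s with
  | var i => simp [Trm.close, Trm.val, val_numeral, listEnv]
  | zero => rfl
  | one => rfl
  | add s u ihs ihu => simp [Trm.close, Trm.val, ihs, ihu]
  | mul s u ihs ihu => simp [Trm.close, Trm.val, ihs, ihu]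

/-- The sentence obtained from `A` by substituting the numerals of `ρ`. -/
def closure (A : Fml) (ρ : List ℕ) : Sentence := ⟨A.close ρ 0, A.cu_close ρ 0⟩

theorem sInst_close (A : Fml) (ρ : List ℕ) (n : ℕ) :
    sInst (A.close ρ 1) (A.cu_close ρ 1) n = closure A (n :: ρ) :=
  Subtype.ext (A.sub_close n ρ 0)

theorem closure_nil (A : Sentence) : closure A.1 [] = A :=
  Subtype.ext (A.1.close_of_cu [] 0 A.2)

/-! ### Computability of the syntactic operations -/

theorem tup_primrec {α : Type*} [Primcodable α] {f : α → List ℕ} (hf : Primrec f) :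
    Primrec fun a => tup (f a) :=
  Primrec.succ.comp (Primrec.encode.comp hf)

theorem enc_numeral_primrec : Primrec fun n => (numeral n).enc := by
  refine (Primrec.nat_rec₁ 1 (f := fun _ m => 5 * Nat.pair m 2 + 3) ?_).of_eq fun n => ?_
  · exact Primrec.nat_add.comp (Primrec.nat_mul.comp (Primrec.const 5)
      (Primrec₂.natPair.comp Primrec.snd (Primrec.const 2))) (Primrec.const 3)
  · induction n with
    | zero => rfl
    | succ n ih =>
      simp only [numeral, Trm.enc]
      rw [← ih]

theorem affine_pair_primrec {α : Type*} [Primcodable α] (m d : ℕ) {f g : α → ℕ}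
    (hf : Primrec f) (hg : Primrec g) : Primrec fun a => m * Nat.pair (f a) (g a) + d :=
  Primrec.nat_add.comp (Primrec.nat_mul.comp (Primrec.const m) (Primrec₂.natPair.comp hf hg))
    (Primrec.const d)

theorem Trm.enc_close_primrec (k : ℕ) (s : Trm) : Primrec fun ρ => (s.close ρ k).enc := by
  induction s with
  | var i =>
    by_cases h : i < k
    · simpa [Trm.close, h] using Primrec.const _
    · simp only [Trm.close, if_neg h]
      exact enc_numeral_primrec.comp ((Primrec.list_getD 0).comp Primrec.id (Primrec.const _))
  | zero => exact Primrec.const _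
  | one => exact Primrec.const _
  | add s u ihs ihu => exact affine_pair_primrec 5 3 ihs ihu
  | mul s u ihs ihu => exact affine_pair_primrec 5 4 ihs ihu

theorem Fml.enc_close_primrec (A : Fml) (k : ℕ) : Primrec fun ρ => (A.close ρ k).enc := by
  induction A generalizing k with
  | eq s u => exact affine_pair_primrec 6 0 (s.enc_close_primrec k) (u.enc_close_primrec k)
  | ne s u => exact affine_pair_primrec 6 1 (s.enc_close_primrec k) (u.enc_close_primrec k)
  | and A B ihA ihB => exact affine_pair_primrec 6 2 (ihA k) (ihB k)
  | or A B ihA ihB => exact affine_pair_primrec 6 3 (ihA k) (ihB k)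
  | all A ih =>
    exact Primrec.nat_add.comp (Primrec.nat_mul.comp (Primrec.const 6) (ih (k + 1)))
      (Primrec.const 4)
  | ex A ih =>
    exact Primrec.nat_add.comp (Primrec.nat_mul.comp (Primrec.const 6) (ih (k + 1)))
      (Primrec.const 5)

theorem encF_closure_primrec (A : Fml) : Primrec fun ρ => encF (closure A ρ) :=
  A.enc_close_primrec 0

theorem Trm.val_listEnv_primrec (s : Trm) : Primrec fun ρ => s.val (listEnv ρ) := by
  induction s with
  | var i => exact (Primrec.list_getD 0).comp Primrec.id (Primrec.const i)
  | zero => exact Primrec.const _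
  | one => exact Primrec.const _
  | add s u ihs ihu => exact Primrec.nat_add.comp ihs ihu
  | mul s u ihs ihu => exact Primrec.nat_mul.comp ihs ihu

/-- The Gödel number of `Γ ∪ {A}` as a function of those of `Γ` and `A`. -/
def insertCode (g x : ℕ) : ℕ :=
  encode ((ofNat (List ℕ) g).filter (· < x) ++ x :: (ofNat (List ℕ) g).filter (x < ·))

theorem insertCode_primrec : Primrec₂ insertCode := by
  have hl : Primrec fun p : ℕ × ℕ => ofNat (List ℕ) p.1 := (Primrec.ofNat _).comp Primrec.fst
  have h₁ := (PrimrecRel.listFilter Primrec.nat_lt).comp hl Primrec.snd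
  have h₂ := (PrimrecRel.listFilter (R := fun a b : ℕ => b < a) Primrec.nat_lt.swap).comp hl
    Primrec.snd
  exact Primrec.encode.comp
    (Primrec.list_append.comp h₁ (Primrec.list_cons.comp Primrec.snd h₂))

theorem encode_list_map_encode {α : Type*} [Encodable α] (l : List α) :
    encode (l.map encode) = encode l := by
  induction l with
  | nil => rfl
  | cons a l ih => simp [ih]

/-- The order of sentences by their Gödel numbers. -/
def codeLE : Sentence → Sentence → Prop := fun a b => encode a ≤ encode b

instance : DecidableRel codeLE := fun a b => Nat.decLe (encode a) (encode b)

instance : IsLinearOrder Sentence codeLE :=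
  (RelEmbedding.preimage ⟨encode, encode_injective⟩ (· ≤ ·)).isLinearOrder

/-- The Gödel number of a sequent codes the increasing list of the Gödel numbers of its members. -/
theorem exists_sortedLT_encS (Γ : Finset Sentence) :
    ∃ L : List ℕ, encS Γ = encode L ∧ L.SortedLT ∧ ∀ x, x ∈ L ↔ ∃ A ∈ Γ, encF A = x := by
  obtain ⟨l, he, hl, hs⟩ : ∃ l : List Sentence, encS Γ = encode l ∧ (l : Multiset Sentence) = Γ.1 ∧
      l.Pairwise fun a b => encode a ≤ encode b :=
    ⟨Γ.1.sort codeLE, rfl, Multiset.sort_eq _ _, Multiset.pairwise_sort _ codeLE⟩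
  have hnd : l.Nodup := by
    rw [← Multiset.coe_nodup, hl]
    exact Γ.2
  refine ⟨l.map encode, by rw [he, encode_list_map_encode], List.Pairwise.sortedLT ?_, fun x => ?_⟩
  · rw [List.pairwise_map]
    exact (hs.and hnd).imp fun h => lt_of_le_of_ne h.1 fun e => h.2 (encode_injective e)
  · have hm : ∀ A, A ∈ l ↔ A ∈ Γ := fun A => by rw [← Finset.mem_val, ← hl, Multiset.mem_coe]
    simp [hm, encF]

theorem encS_union_singleton (Γ : Finset Sentence) (A : Sentence) :
    encS (Γ ∪ {A}) = insertCode (encS Γ) (encF A) := by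
  obtain ⟨L, hL, hs, hm⟩ := exists_sortedLT_encS Γ
  obtain ⟨M, hM, hs', hm'⟩ := exists_sortedLT_encS (Γ ∪ {A})
  rw [insertCode, hL, hM, ofNat_encode]
  congr 1
  refine hs'.eq_of_mem_iff (List.Pairwise.sortedLT ?_) fun x => ?_
  · rw [List.pairwise_append, List.pairwise_cons]
    refine ⟨hs.pairwise.filter _, ⟨?_, hs.pairwise.filter _⟩, ?_⟩
    · simp
    · intro a ha b hb
      simp only [List.mem_filter, List.mem_cons, decide_eq_true_eq] at ha hb
      omega
  · rw [hm']
    have : (∃ B ∈ Γ ∪ {A}, encF B = x) ↔ (∃ B ∈ Γ, encF B = x) ∨ encF A = x := by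
      rw [or_comm]
      simp [or_and_right, exists_or]
    rw [this, ← hm]
    simp only [List.mem_append, List.mem_filter, List.mem_cons, decide_eq_true_eq]
    rcases lt_trichotomy x (encF A) with h | h | h
    · simp [h, h.ne, h.ne', h.le]
    · simp [h]
    · simp [h, h.ne, h.ne', h.le]

/-! ### The proof search procedure

A search state consists of the Gödel number of a sequent and a queue of tasks.  A task
`(h, n, ρ)` asks to analyse the formula handled by the partial recursive function with
index `h` in the environment `ρ`; the number `n` counts the instances of an existential
formula tried so far. -/

/-- Tasks of the proof search. -/
abbrev Task : Type := ℕ × ℕ × List ℕ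

/-- An index of the partial recursive function `f`. -/
noncomputable def index {α : Type} [Primcodable α] (f : α →. ℕ) : ℕ :=
  Classical.epsilon fun e => ∀ a, peval e (encode a) = f a

theorem peval_index {α : Type} [Primcodable α] {f : α →. ℕ} (hf : Partrec f) (a : α) :
    peval (index f) (encode a) = f a := by
  obtain ⟨c, hc⟩ := Code.exists_code.1 hf
  refine Classical.epsilon_spec (p := fun e => ∀ a, peval e (encode a) = f a)
    ⟨encode c, fun a => ?_⟩ a
  simp [peval, hc, Part.map_id']

theorem peval_partrec : Partrec₂ peval :=
  Code.eval_part.comp ((Computable.ofNat Code).comp Computable.fst) Computable.snd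

/-- Run the proof search: call the handler of the first task of the queue. -/
def run (s : ℕ × List Task) : Part ℕ :=
  peval s.2.headI.1 (encode (s.2.headI, s.1, s.2.tail))

theorem run_partrec : Partrec run := by
  have hh : Primrec fun s : ℕ × List Task => s.2.headI := Primrec.list_headI.comp Primrec.snd
  exact peval_partrec.comp (Primrec.fst.comp hh).to_comp
    (Primrec.encode.comp (hh.pair (Primrec.fst.pair (Primrec.list_tail.comp Primrec.snd)))).to_comp

/-- Add a formula to the sequent, and a task for its analysis to the queue. -/
def push (A : Fml) (h : ℕ) (ρ : List ℕ) (s : ℕ × List Task) : ℕ × List Task :=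
  (insertCode s.1 (encF (closure A ρ)), s.2 ++ [(h, 0, ρ)])

theorem push_primrec {α : Type*} [Primcodable α] (A : Fml) (h : ℕ) {f : α → List ℕ}
    {g : α → ℕ × List Task} (hf : Primrec f) (hg : Primrec g) :
    Primrec fun a => push A h (f a) (g a) :=
  (insertCode_primrec.comp (Primrec.fst.comp hg) ((encF_closure_primrec A).comp hf)).pair
    (Primrec.list_concat.comp (Primrec.snd.comp hg)
      ((Primrec.const h).pair ((Primrec.const 0).pair hf)))

/-- Handler of a literal whose truth value in an environment is given by `b`. -/
def litStep (b : List ℕ → Bool) (x : Task × ℕ × List Task) : Part ℕ :=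
  cond (b x.1.2.2) (Part.some (tup [axC, x.2.1])) (run x.2)

/-- Handler of `A ∧ B`. -/
def andStep (A B : Fml) (hA hB : ℕ) (x : Task × ℕ × List Task) : Part ℕ :=
  (run (push A hA x.1.2.2 x.2)).bind fun a => (run (push B hB x.1.2.2 x.2)).map fun b =>
    tup [andC, x.2.1, encF (closure (A.and B) x.1.2.2), a, b]

/-- Handler of `A ∨ B`. -/
def orStep (A B : Fml) (hA hB : ℕ) (x : Task × ℕ × List Task) : Part ℕ :=
  (run (push B hB x.1.2.2 (push A hA x.1.2.2 x.2))).map fun a =>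
    tup [orC, x.2.1, encF (closure (A.or B) x.1.2.2), a]

/-- The function enumerating the premises of the `ω`-rule. -/
def allPremise (A : Fml) (hA : ℕ) (x : (Task × ℕ × List Task) × ℕ) : Part ℕ :=
  run (push A hA (x.2 :: x.1.1.2.2) x.1.2)

/-- Index of the function `n ↦ f (x, n)`, where `e` is an index of `f`. -/
def specializeIndex {α : Type} [Primcodable α] (e : ℕ) (x : α) : ℕ :=
  encode (Code.curry (ofNat Code e) (encode x))

/-- Handler of `∀x A(x)`. -/
noncomputable def allStep (A : Fml) (hA : ℕ) (x : Task × ℕ × List Task) : Part ℕ :=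
  Part.some (tup [omC, x.2.1, encF (closure A.all x.1.2.2),
    specializeIndex (index (allPremise A hA)) x])

/-- Queue the next instance of an existential formula, and the formula itself once more. -/
def exNext (A : Fml) (hA : ℕ) (x : Task × ℕ × List Task) : ℕ × List Task :=
  ((push A hA (x.1.2.1 :: x.1.2.2) x.2).1,
    (push A hA (x.1.2.1 :: x.1.2.2) x.2).2 ++ [(x.1.1, x.1.2.1 + 1, x.1.2.2)])

/-- Handler of `∃x A(x)`. -/
def exStep (A : Fml) (hA : ℕ) (x : Task × ℕ × List Task) : Part ℕ :=
  (run (exNext A hA x)).map fun a => tup [exC, x.2.1, encF (closure A.ex x.1.2.2), a]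

/-- The index of the handler of a formula. -/
noncomputable def handler : Fml → ℕ
  | .eq s u => index (litStep fun ρ => decide (s.val (listEnv ρ) = u.val (listEnv ρ)))
  | .ne s u => index (litStep fun ρ => decide (s.val (listEnv ρ) ≠ u.val (listEnv ρ)))
  | .and A B => index (andStep A B (handler A) (handler B))
  | .or A B => index (orStep A B (handler A) (handler B))
  | .all A => index (allStep A (handler A))
  | .ex A => index (exStep A (handler A))

theorem env_primrec : Primrec fun x : Task × ℕ × List Task => x.1.2.2 :=
  Primrec.snd.comp (Primrec.snd.comp Primrec.fst)

theorem litStep_partrec {b : List ℕ → Bool} (hb : Primrec b) : Partrec (litStep b) :=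
  Partrec.cond (hb.comp env_primrec).to_comp
    (tup_primrec (Primrec.list_cons.comp (Primrec.const axC) (Primrec.list_cons.comp
      (Primrec.fst.comp Primrec.snd) (Primrec.const [])))).to_comp
    (run_partrec.comp Computable.snd)

theorem inference_primrec {α : Type*} [Primcodable α] (R : ℕ) (A : Fml)
    {f : α → Task × ℕ × List Task} {l : α → List ℕ} (hf : Primrec f) (hl : Primrec l) :
    Primrec fun a => tup (R :: (f a).2.1 :: encF (closure A (f a).1.2.2) :: l a) :=
  tup_primrec (Primrec.list_cons.comp (Primrec.const R) (Primrec.list_cons.comp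
    (Primrec.fst.comp (Primrec.snd.comp hf)) (Primrec.list_cons.comp
      ((encF_closure_primrec A).comp (env_primrec.comp hf)) hl)))

theorem singleton_primrec {α : Type*} [Primcodable α] {f : α → ℕ} (hf : Primrec f) :
    Primrec fun a => [f a] :=
  Primrec.list_cons.comp hf (Primrec.const [])

theorem andStep_partrec (A B : Fml) (hA hB : ℕ) : Partrec (andStep A B hA hB) := by
  refine (run_partrec.comp (push_primrec A hA env_primrec Primrec.snd).to_comp).bind ?_
  refine ((run_partrec.comp (push_primrec B hB env_primrec Primrec.snd).to_comp).comp
    Computable.fst).map ?_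
  exact (inference_primrec andC (A.and B) (Primrec.fst.comp Primrec.fst) (Primrec.list_cons.comp
    (Primrec.snd.comp Primrec.fst) (singleton_primrec Primrec.snd))).to_comp

theorem orStep_partrec (A B : Fml) (hA hB : ℕ) : Partrec (orStep A B hA hB) := by
  refine (run_partrec.comp (push_primrec B hB env_primrec
    (push_primrec A hA env_primrec Primrec.snd)).to_comp).map ?_
  exact (inference_primrec orC (A.or B) Primrec.fst (singleton_primrec Primrec.snd)).to_comp

theorem allPremise_partrec (A : Fml) (hA : ℕ) : Partrec (allPremise A hA) :=
  run_partrec.comp (push_primrec A hA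
    (Primrec.list_cons.comp Primrec.snd (env_primrec.comp Primrec.fst))
    (Primrec.snd.comp Primrec.fst)).to_comp

theorem specializeIndex_primrec {α : Type} [Primcodable α] (e : ℕ) :
    Primrec (specializeIndex (α := α) e) :=
  Primrec.encode.comp (Code.primrec₂_curry.comp (Primrec.const _) Primrec.encode)

theorem peval_specializeIndex {α : Type} [Primcodable α] (e : ℕ) (x : α) (n : ℕ) :
    peval (specializeIndex e x) n = peval e (encode (x, n)) := by
  simp [peval, specializeIndex, Code.eval_curry]

theorem allStep_partrec (A : Fml) (hA : ℕ) : Partrec (allStep A hA) :=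
  (inference_primrec omC A.all Primrec.id
    (singleton_primrec (specializeIndex_primrec (index (allPremise A hA))))).to_comp

theorem exNext_primrec (A : Fml) (hA : ℕ) : Primrec (exNext A hA) := by
  have hn : Primrec fun x : Task × ℕ × List Task => x.1.2.1 :=
    Primrec.fst.comp (Primrec.snd.comp Primrec.fst)
  have hp := push_primrec A hA (Primrec.list_cons.comp hn env_primrec) Primrec.snd
  exact (Primrec.fst.comp hp).pair (Primrec.list_concat.comp (Primrec.snd.comp hp)
    ((Primrec.fst.comp Primrec.fst).pair ((Primrec.succ.comp hn).pair env_primrec)))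

theorem exStep_partrec (A : Fml) (hA : ℕ) : Partrec (exStep A hA) := by
  refine (run_partrec.comp (exNext_primrec A hA).to_comp).map ?_
  exact (inference_primrec exC A.ex Primrec.fst (singleton_primrec Primrec.snd)).to_comp

/-! ### Completeness -/

/-- The task of analysing the formula `t.1` in the environment `t.2.2`. -/
noncomputable def toTask (t : Fml × ℕ × List ℕ) : Task := (handler t.1, t.2)

/-- The proof search with queue `q` succeeds, for all sequents containing the formulas of `q`. -/
def Succeeds (c : Bool) (q : List (Fml × ℕ × List ℕ)) : Prop :=
  ∀ Γ : Finset Sentence, (∀ t ∈ q, closure t.1 t.2.2 ∈ Γ) →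
    ∃ a ∈ run (encS Γ, q.map toTask), CGen c false false a ∧ EndS a = Γ

/-- The lists of tasks added to the queue in the premises of the inference for a task. -/
def premises : Fml × ℕ × List ℕ → Set (List (Fml × ℕ × List ℕ))
  | (.eq s u, _, ρ) => {q | q = [] ∧ s.val (listEnv ρ) ≠ u.val (listEnv ρ)}
  | (.ne s u, _, ρ) => {q | q = [] ∧ s.val (listEnv ρ) = u.val (listEnv ρ)}
  | (.and A B, _, ρ) => {[(A, 0, ρ)], [(B, 0, ρ)]}
  | (.or A B, _, ρ) => {[(A, 0, ρ), (B, 0, ρ)]}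
  | (.all A, _, ρ) => Set.range fun n => [(A, 0, n :: ρ)]
  | (.ex A, n, ρ) => {[(A, 0, n :: ρ), (.ex A, n + 1, ρ)]}

theorem run_cons (g : ℕ) (t : Fml × ℕ × List ℕ) (q : List (Fml × ℕ × List ℕ)) :
    run (g, (t :: q).map toTask) =
      peval (handler t.1) (encode (toTask t, g, q.map toTask)) := rfl

theorem push_encS (A : Fml) (ρ : List ℕ) (Γ : Finset Sentence) (q : List (Fml × ℕ × List ℕ)) :
    push A (handler A) ρ (encS Γ, q.map toTask) =
      (encS (Γ ∪ {closure A ρ}), (q ++ [(A, 0, ρ)]).map toTask) := by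
  simp [push, ← encS_union_singleton, toTask]

theorem mem_union_of_mem_append {Γ Δ : Finset Sentence} {q p : List (Fml × ℕ × List ℕ)}
    (hq : ∀ t ∈ q, closure t.1 t.2.2 ∈ Γ) (hp : ∀ t ∈ p, closure t.1 t.2.2 ∈ Γ ∪ Δ) :
    ∀ t ∈ q ++ p, closure t.1 t.2.2 ∈ Γ ∪ Δ := by
  intro t ht
  rcases List.mem_append.1 ht with h | h
  · exact Finset.mem_union_left _ (hq t h)
  · exact hp t h

theorem EndS_principal_of_mem {R : ℕ} (hR : R ≠ cutC ∧ R ≠ axC ∧ R ≠ omrepC)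
    {Γ : Finset Sentence} {A : Sentence} (hA : A ∈ Γ) (l : List ℕ) :
    EndS (tup (R :: encS Γ :: encF A :: l)) = Γ := by
  rw [EndS_principal hR, Finset.union_eq_left, Finset.singleton_subset_iff]
  exact hA

theorem succeeds_literal {c : Bool} {A : Fml} {n : ℕ} {ρ : List ℕ} {b : List ℕ → Bool}
    {q : List (Fml × ℕ × List ℕ)} (hb : Primrec b) (hA : handler A = index (litStep b))
    (hlit : (closure A ρ).1.isLiteral = true) (htrue : b ρ = true → sentTrue (closure A ρ))
    (h : b ρ = false → Succeeds c q) : Succeeds c ((A, n, ρ) :: q) := by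
  intro Γ hΓ
  rw [run_cons, hA, peval_index (litStep_partrec hb)]
  cases hρ : b ρ with
  | true =>
    refine ⟨tup [axC, encS Γ], by simp [litStep, toTask, hρ], ?_, EndS_ax Γ⟩
    exact CGen.ax Γ ⟨_, hΓ _ List.mem_cons_self, hlit, htrue hρ⟩
  | false =>
    simpa [litStep, toTask, hρ] using h hρ Γ fun t ht => hΓ t (List.mem_cons_of_mem _ ht)

theorem succeeds_cons {c : Bool} {t : Fml × ℕ × List ℕ} {q : List (Fml × ℕ × List ℕ)}
    (h : ∀ p ∈ premises t, Succeeds c (q ++ p)) : Succeeds c (t :: q) := by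
  obtain ⟨A, n, ρ⟩ := t
  cases A with
  | eq s u =>
    refine succeeds_literal ?_ rfl rfl ?_ ?_
    · exact (Primrec.eq.comp s.val_listEnv_primrec u.val_listEnv_primrec).decide
    · intro hb
      show (s.close ρ 0).val _ = (u.close ρ 0).val _
      simpa [Trm.val_close] using hb
    · intro hb
      simpa using h [] (by simpa [premises] using hb)
  | ne s u =>
    refine succeeds_literal ?_ rfl rfl ?_ ?_
    · exact (Primrec.eq.comp s.val_listEnv_primrec u.val_listEnv_primrec).not.decide
    · intro hb
      show (s.close ρ 0).val _ ≠ (u.close ρ 0).val _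
      simpa [Trm.val_close] using hb
    · intro hb
      simpa using h [] (by simpa [premises] using hb)
  | and A B =>
    intro Γ hΓ
    obtain ⟨hmem, hq⟩ := List.forall_mem_cons.1 hΓ
    obtain ⟨a, ha, hCa, hEa⟩ := h [(A, 0, ρ)] (by simp [premises]) (Γ ∪ {closure A ρ})
      (mem_union_of_mem_append hq (by simp))
    obtain ⟨b, hb, hCb, hEb⟩ := h [(B, 0, ρ)] (by simp [premises]) (Γ ∪ {closure B ρ})
      (mem_union_of_mem_append hq (by simp))
    rw [← push_encS] at ha hb
    rw [run_cons, handler, peval_index (andStep_partrec _ _ _ _)]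
    exact ⟨_, Part.mem_bind ha (Part.mem_map _ hb), CGen.and Γ (closure A ρ) (closure B ρ)
      hCa hCb hEa hEb, EndS_principal_of_mem (by decide) hmem _⟩
  | or A B =>
    intro Γ hΓ
    obtain ⟨hmem, hq⟩ := List.forall_mem_cons.1 hΓ
    obtain ⟨a, ha, hCa, hEa⟩ := h [(A, 0, ρ), (B, 0, ρ)] (by simp [premises])
      (Γ ∪ {closure A ρ, closure B ρ}) (mem_union_of_mem_append hq (by simp))
    have hstate : push B (handler B) ρ (push A (handler A) ρ (encS Γ, q.map toTask)) =
        (encS (Γ ∪ {closure A ρ, closure B ρ}),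
          (q ++ [(A, 0, ρ), (B, 0, ρ)]).map toTask) := by
      rw [push_encS, push_encS, Finset.union_assoc, List.append_assoc]
      rfl
    rw [← hstate] at ha
    rw [run_cons, handler, peval_index (orStep_partrec _ _ _ _)]
    exact ⟨_, Part.mem_map _ ha, CGen.or Γ (closure A ρ) (closure B ρ) hCa hEa,
      EndS_principal_of_mem (by decide) hmem _⟩
  | all A =>
    intro Γ hΓ
    obtain ⟨hmem, hq⟩ := List.forall_mem_cons.1 hΓ
    set x : Task × ℕ × List Task := (toTask (A.all, n, ρ), encS Γ, q.map toTask)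
    have hprem : ∀ m, ∃ a ∈ peval (specializeIndex (index (allPremise A (handler A))) x) m,
        CGen c false false a ∧ EndS a = Γ ∪ {sInst (A.close ρ 1) (A.cu_close ρ 1) m} := by
      intro m
      obtain ⟨a, ha, hCa, hEa⟩ := h [(A, 0, m :: ρ)] ⟨m, rfl⟩ (Γ ∪ {closure A (m :: ρ)})
        (mem_union_of_mem_append hq (by simp))
      rw [← push_encS] at ha
      refine ⟨a, ?_, hCa, by rw [hEa, sInst_close]⟩
      rwa [peval_specializeIndex, peval_index (allPremise_partrec _ _)]
    rw [run_cons, handler, peval_index (allStep_partrec _ _)]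
    refine ⟨_, Part.mem_some _, CGen.om Γ (A.close ρ 1) (A.cu_close ρ 1) (by simp)
      (fun m => Part.dom_iff_mem.2 ⟨_, (hprem m).choose_spec.1⟩) (fun m => ?_) (fun m => ?_),
      EndS_principal_of_mem (by decide) hmem _⟩
    all_goals obtain ⟨a, ha, hCa, hEa⟩ := hprem m
    · rwa [Part.get_eq_of_mem ha]
    · rwa [Part.get_eq_of_mem ha]
  | ex A =>
    intro Γ hΓ
    obtain ⟨hmem, hq⟩ := List.forall_mem_cons.1 hΓ
    obtain ⟨a, ha, hCa, hEa⟩ := h [(A, 0, n :: ρ), (A.ex, n + 1, ρ)] (by simp [premises])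
      (Γ ∪ {closure A (n :: ρ)})
      (mem_union_of_mem_append hq (by simpa using Or.inr hmem))
    have hstate : exNext A (handler A) (toTask (A.ex, n, ρ), encS Γ, q.map toTask) =
        (encS (Γ ∪ {closure A (n :: ρ)}),
          (q ++ [(A, 0, n :: ρ), (A.ex, n + 1, ρ)]).map toTask) := by
      simp [exNext, push, ← encS_union_singleton, toTask]
    rw [← hstate] at ha
    rw [run_cons, handler, peval_index (exStep_partrec _ _)]
    exact ⟨_, Part.mem_map _ ha, CGen.ex Γ (A.close ρ 1) (A.cu_close ρ 1) n hCa
      (by rw [hEa, sInst_close]), EndS_principal_of_mem (by decide) hmem _⟩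

theorem succeeds_append_cons {c : Bool} {t : Fml × ℕ × List ℕ}
    (h : ∀ q, Succeeds c (t :: q)) (q₁ q₂ : List (Fml × ℕ × List ℕ)) :
    Succeeds c (q₁ ++ t :: q₂) := by
  induction q₁ generalizing q₂ with
  | nil => exact h q₂
  | cons u q₁ ih =>
    refine succeeds_cons fun p _ => ?_
    simpa using ih (q₂ ++ p)

/-- The proof search succeeds as soon as the queue contains a true formula. -/
theorem succeeds_of_sat (c : Bool) (A : Fml) (ρ : List ℕ) (hA : A.Sat (listEnv ρ))
    (q : List (Fml × ℕ × List ℕ)) : Succeeds c ((A, 0, ρ) :: q) := by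
  induction A generalizing ρ q with
  | eq s u => exact succeeds_cons fun p hp => absurd hA hp.2
  | ne s u => exact succeeds_cons fun p hp => absurd hp.2 hA
  | and A B ihA ihB =>
    refine succeeds_cons fun p hp => ?_
    rcases hp with rfl | rfl
    · exact succeeds_append_cons (ihA ρ hA.1) q []
    · exact succeeds_append_cons (ihB ρ hA.2) q []
  | or A B ihA ihB =>
    refine succeeds_cons fun p hp => ?_
    obtain rfl : p = _ := hp
    rcases hA with hA | hB
    · exact succeeds_append_cons (ihA ρ hA) q _
    · rw [List.append_cons]
      exact succeeds_append_cons (ihB ρ hB) (q ++ [(A, 0, ρ)]) []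
  | all A ih =>
    refine succeeds_cons fun p hp => ?_
    obtain ⟨n, rfl⟩ := hp
    exact succeeds_append_cons (ih (n :: ρ) (consEnv_listEnv n ρ ▸ hA n)) q []
  | ex A ih =>
    obtain ⟨m, hm⟩ := hA
    rw [consEnv_listEnv] at hm
    suffices ∀ d n, n + d = m → ∀ q, Succeeds c ((A.ex, n, ρ) :: q) from
      this m 0 (Nat.zero_add m) q
    intro d
    induction d with
    | zero =>
      rintro n rfl q
      refine succeeds_cons fun p hp => ?_
      obtain rfl : p = _ := hp
      exact succeeds_append_cons (ih _ hm) q _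
    | succ d ihd =>
      intro n hn q
      refine succeeds_cons fun p hp => ?_
      obtain rfl : p = _ := hp
      rw [List.append_cons]
      exact succeeds_append_cons (ihd (n + 1) (by omega)) (q ++ [(A, 0, n :: ρ)]) []

theorem exists_CGen_of_sentTrue (c : Bool) (A : Sentence) (hA : sentTrue A) :
    ∃ a, CGen c false false a ∧ EndS a = {A} := by
  obtain ⟨a, -, h⟩ := succeeds_of_sat c A.1 [] hA [] {A} (by simp [closure_nil])
  exact ⟨a, h⟩

theorem sentTrue_iff_exists_CGen (c : Bool) (A : Sentence) :
    sentTrue A ↔ ∃ a, CGen c false false a ∧ EndS a = {A} := by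
  refine ⟨exists_CGen_of_sentTrue c A, ?_⟩
  rintro ⟨a, ha, hE⟩
  rw [← seqTrue_singleton, ← hE]
  exact ha.seqTrue_EndS

/-- A sentence is true in `ℕ` iff it has a proof code in `C_rec` iff it has a
proof code in `C_rec^-`; hence `thm(C_rec) = thm(C_rec^-)` is the set of true
arithmetical sentences. -/
theorem crec_complete_and_sound (A : Sentence) :
    (sentTrue A ↔ ∃ a : ℕ, Crec a ∧ EndS a = {A}) ∧
    (sentTrue A ↔ ∃ a : ℕ, CrecM a ∧ EndS a = {A}) := by
  exact ⟨sentTrue_iff_exists_CGen true A, sentTrue_iff_exists_CGen false A⟩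

end Shoen
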